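/- If there exists a sorting network on n channels with depth d, then there exists a co-saturated sorting network on n channels with depth d. -/

import Mathlib

/-- Apply one parallel layer of comparators to a 0/1 vector (Bool: false = 0, true = 1):
each comparator `(i,j)` puts the minimum on channel `i` and the maximum on channel `j`. -/
def applyLayer {n : ℕ} (L : Finset (Fin n × Fin n)) (x : Fin n → Bool) : Fin n → Bool :=
  fun c => (x c && decide (∀ j, (c, j) ∈ L → x j = true)) ||
           decide (∃ i, (i, c) ∈ L ∧ x i = true)

/-- Apply a comparator network (a list of layers) to a 0/1 vector, layer by layer. -/
def applyNet {n : ℕ} (C : List (Finset (Fin n × Fin n))) (x : Fin n → Bool) : Fin n → Bool :=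
  C.foldl (fun v L => applyLayer L v) x

/-- A valid layer: each comparator `(i,j)` has `i < j`, and every channel appears
in at most one comparator of the layer. -/
def ValidLayer {n : ℕ} (L : Finset (Fin n × Fin n)) : Prop :=
  (∀ p ∈ L, p.1 < p.2) ∧
  ∀ p ∈ L, ∀ q ∈ L, p ≠ q → p.1 ≠ q.1 ∧ p.1 ≠ q.2 ∧ p.2 ≠ q.1 ∧ p.2 ≠ q.2

/-- A valid comparator network: every layer is valid. -/
def ValidNet {n : ℕ} (C : List (Finset (Fin n × Fin n))) : Prop :=
  ∀ L ∈ C, ValidLayer L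

/-- A 0/1 vector is sorted in ascending order. -/
def SortedVec {n : ℕ} (x : Fin n → Bool) : Prop :=
  ∀ i j : Fin n, i ≤ j → x i ≤ x j

/-- A sorting network: a valid network sorting every 0/1 input. -/
def SortingNet {n : ℕ} (C : List (Finset (Fin n × Fin n))) : Prop :=
  ValidNet C ∧ ∀ x : Fin n → Bool, SortedVec (applyNet C x)

/-- Channel `c` is used in layer `L`. -/
def UsedIn {n : ℕ} (c : Fin n) (L : Finset (Fin n × Fin n)) : Prop :=
  ∃ q ∈ L, q.1 = c ∨ q.2 = c

/-- A network of depth `d ≥ 1` is in last layer normal form: every comparator of the last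
layer is of the form `(i,i+1)`, and no two adjacent channels are both unused in the last
layer. -/
def LLNF {n : ℕ} (C : List (Finset (Fin n × Fin n))) : Prop :=
  (∀ p ∈ C.getD (C.length - 1) ∅, (p.2 : ℕ) = (p.1 : ℕ) + 1) ∧
  (∀ i j : Fin n, (j : ℕ) = (i : ℕ) + 1 →
    UsedIn i (C.getD (C.length - 1) ∅) ∨ UsedIn j (C.getD (C.length - 1) ∅))

/-- Channels `i` and `j` are in the same `k`-block: the equivalence relation generated
by the comparators occurring in the layers of 0-based index ≥ `k` (that is, the layers
`L_{k'}` with `k' > k` in the 1-based numbering of the layers `L_1;…;L_d`). -/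
def blockRel {n : ℕ} (C : List (Finset (Fin n × Fin n))) (k : ℕ) : Fin n → Fin n → Prop :=
  Relation.EqvGen (fun i j => ∃ L ∈ C.drop k, (i, j) ∈ L ∨ (j, i) ∈ L)

/-- `B` is a `k`-block of `C`: an equivalence class of `blockRel C k`. -/
def IsBlock {n : ℕ} (C : List (Finset (Fin n × Fin n))) (k : ℕ) (B : Finset (Fin n)) : Prop :=
  ∃ i : Fin n, ∀ j : Fin n, j ∈ B ↔ blockRel C k i j

/-- Two distinct blocks `A` and `B` are adjacent: `max A + 1 = min B` or `max B + 1 = min A`. -/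
def AdjacentBlocks {n : ℕ} (A B : Finset (Fin n)) : Prop :=
  A ≠ B ∧ ∃ (hA : A.Nonempty) (hB : B.Nonempty),
    ((A.max' hA : ℕ) + 1 = (B.min' hB : ℕ)) ∨ ((B.max' hB : ℕ) + 1 = (A.min' hA : ℕ))

/-- A sorting network of depth `d` is co-saturated: (i) it is in last layer normal form;
(ii) no two adjacent blocks (classes generated by the last layer, i.e. `(d-1)`-blocks)
both contain a channel unused in layer `d-1` (0-based index `d - 2`); (iii) whenever
`(i, i+1)` is a comparator of the last layer with both its channels unused in layer `d-1`,
the channels `i-1` and `i+2` (whenever they exist) are used in the last layer. -/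
def CoSaturated {n : ℕ} (C : List (Finset (Fin n × Fin n))) : Prop :=
  LLNF C ∧
  (∀ A B : Finset (Fin n),
    IsBlock C (C.length - 1) A → IsBlock C (C.length - 1) B → AdjacentBlocks A B →
    ¬ ((∃ a ∈ A, ¬ UsedIn a (C.getD (C.length - 2) ∅)) ∧
       (∃ b ∈ B, ¬ UsedIn b (C.getD (C.length - 2) ∅)))) ∧
  (∀ p ∈ C.getD (C.length - 1) ∅,
    ¬ UsedIn p.1 (C.getD (C.length - 2) ∅) → ¬ UsedIn p.2 (C.getD (C.length - 2) ∅) →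
    (∀ c : Fin n, (c : ℕ) + 1 = (p.1 : ℕ) → UsedIn c (C.getD (C.length - 1) ∅)) ∧
    (∀ c : Fin n, (c : ℕ) = (p.2 : ℕ) + 1 → UsedIn c (C.getD (C.length - 1) ∅)))

theorem al_true {n : ℕ} (L : Finset (Fin n × Fin n)) (x : Fin n → Bool) (c : Fin n) :
    applyLayer L x c = true ↔ (x c = true ∧ ∀ j, (c, j) ∈ L → x j = true) ∨
      ∃ i, (i, c) ∈ L ∧ x i = true := by
  simp [applyLayer]

theorem valid_fst {n : ℕ} {L : Finset (Fin n × Fin n)} (h : ValidLayer L) {a b c : Fin n}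
    (h1 : (a, b) ∈ L) (h2 : (a, c) ∈ L) : b = c := by
  by_contra hne
  exact (h.2 _ h1 _ h2 (by simp [hne])).1 rfl

theorem valid_snd {n : ℕ} {L : Finset (Fin n × Fin n)} (h : ValidLayer L) {a b c : Fin n}
    (h1 : (a, c) ∈ L) (h2 : (b, c) ∈ L) : a = b := by
  by_contra hne
  exact (h.2 _ h1 _ h2 (by simp [hne])).2.2.2 rfl

theorem valid_mid {n : ℕ} {L : Finset (Fin n × Fin n)} (h : ValidLayer L) {a b c : Fin n}
    (h1 : (a, b) ∈ L) (h2 : (b, c) ∈ L) : False := by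
  have hab := h.1 _ h1
  have hne : (a, b) ≠ (b, c) := by
    intro h; simp at h; simp [h.1] at hab
  exact (h.2 _ h1 _ h2 hne).2.2.1 rfl

theorem valid_subset {n : ℕ} {S T : Finset (Fin n × Fin n)} (hST : S ⊆ T) (h : ValidLayer T) :
    ValidLayer S :=
  ⟨fun p hp => h.1 p (hST hp), fun p hp q hq => h.2 p (hST hp) q (hST hq)⟩

theorem valid_insert {n : ℕ} {L : Finset (Fin n × Fin n)} (h : ValidLayer L) {a b : Fin n}
    (hab : a < b) (ha : ¬ UsedIn a L) (hb : ¬ UsedIn b L) : ValidLayer (insert (a, b) L) := by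
  unfold UsedIn at ha hb
  push Not at ha hb
  constructor
  · intro p hp
    rcases Finset.mem_insert.1 hp with rfl | hp
    · exact hab
    · exact h.1 p hp
  · intro p hp q hq hpq
    rcases Finset.mem_insert.1 hp with rfl | hp <;> rcases Finset.mem_insert.1 hq with rfl | hq
    · exact absurd rfl hpq
    · have := ha q hq; have := hb q hq; grind
    · have := ha p hp; have := hb p hp; grind
    · exact h.2 p hp q hq hpq

theorem redundant {n : ℕ} {S T : Finset (Fin n × Fin n)} {x : Fin n → Bool} (hST : S ⊆ T)
    (hT : ValidLayer T) (h : ∀ p ∈ T, p ∉ S → x p.1 = true → x p.2 = true) :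
    applyLayer S x = applyLayer T x := by
  funext c
  rw [Bool.eq_iff_iff, al_true, al_true]
  constructor
  · rintro (⟨h1, h2⟩ | ⟨i, h1, h2⟩)
    · left
      refine ⟨h1, fun j hj => ?_⟩
      by_cases hS : (c, j) ∈ S
      · exact h2 j hS
      · exact h _ hj hS h1
    · exact Or.inr ⟨i, hST h1, h2⟩
  · rintro (⟨h1, h2⟩ | ⟨i, h1, h2⟩)
    · exact Or.inl ⟨h1, fun j hj => h2 j (hST hj)⟩
    · by_cases hS : (i, c) ∈ S
      · exact Or.inr ⟨i, hS, h2⟩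
      · exact Or.inl ⟨h _ h1 hS h2, fun j hj => (valid_mid hT h1 (hST hj)).elim⟩

theorem al_empty {n : ℕ} (x : Fin n → Bool) : applyLayer ∅ x = x := by
  funext c
  rw [Bool.eq_iff_iff, al_true]; simp

theorem al_sorted {n : ℕ} {L : Finset (Fin n × Fin n)} (hL : ValidLayer L) {x : Fin n → Bool}
    (hx : SortedVec x) : applyLayer L x = x := by
  rw [← redundant (Finset.empty_subset L) hL, al_empty]
  intro p hp _
  exact Bool.le_iff_imp.1 (hx _ _ (hL.1 p hp).le)

theorem an_sorted {n : ℕ} (C : List (Finset (Fin n × Fin n))) (hC : ValidNet C) {x : Fin n → Bool}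
    (hx : SortedVec x) : applyNet C x = x := by
  induction C with
  | nil => rfl
  | cons L C ih =>
    have : applyNet (L :: C) x = applyNet C (applyLayer L x) := rfl
    rw [this, al_sorted (hC L (by simp)) hx]
    exact ih fun M hM => hC M (by simp [hM])

theorem an_mono {n : ℕ} (C : List (Finset (Fin n × Fin n))) {x y : Fin n → Bool}
    (h : ∀ c, x c = true → y c = true) (c : Fin n) (hc : applyNet C x c = true) :
    applyNet C y c = true := by
  induction C generalizing x y with
  | nil => exact h c hc
  | cons L C ih =>
    refine ih (x := applyLayer L x) (y := applyLayer L y) ?_ hc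
    intro e
    rw [al_true, al_true]
    rintro (⟨h1, h2⟩ | ⟨i, h1, h2⟩)
    · exact Or.inl ⟨h _ h1, fun j hj => h _ (h2 j hj)⟩
    · exact Or.inr ⟨i, h1, h _ h2⟩

theorem al_fst {n : ℕ} {L : Finset (Fin n × Fin n)} (hL : ValidLayer L) {a b : Fin n}
    (h : (a, b) ∈ L) (x : Fin n → Bool) : applyLayer L x a = (x a && x b) := by
  rw [Bool.eq_iff_iff, al_true, Bool.and_eq_true]
  constructor
  · rintro (⟨h1, h2⟩ | ⟨i, h1, h2⟩)
    · exact ⟨h1, h2 _ h⟩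
    · exact (valid_mid hL h1 h).elim
  · rintro ⟨h1, h2⟩
    exact Or.inl ⟨h1, fun j hj => valid_fst hL h hj ▸ h2⟩

theorem al_snd {n : ℕ} {L : Finset (Fin n × Fin n)} (hL : ValidLayer L) {a b : Fin n}
    (h : (a, b) ∈ L) (x : Fin n → Bool) : applyLayer L x b = (x a || x b) := by
  rw [Bool.eq_iff_iff, al_true, Bool.or_eq_true]
  constructor
  · rintro (⟨h1, h2⟩ | ⟨i, h1, h2⟩)
    · exact Or.inr h1
    · exact Or.inl (valid_snd hL h1 h ▸ h2)
  · rintro (h1 | h2)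
    · exact Or.inr ⟨a, h, h1⟩
    · exact Or.inl ⟨h2, fun j hj => (valid_mid hL h hj).elim⟩

theorem al_unused {n : ℕ} {L : Finset (Fin n × Fin n)} {c : Fin n}
    (h : ¬ UsedIn c L) (x : Fin n → Bool) : applyLayer L x c = x c := by
  unfold UsedIn at h
  push Not at h
  rw [Bool.eq_iff_iff, al_true]
  constructor
  · rintro (⟨h1, h2⟩ | ⟨i, h1, h2⟩)
    · exact h1
    · exact absurd rfl (h _ h1).2
  · intro h1
    exact Or.inl ⟨h1, fun j hj => absurd rfl (h _ hj).1⟩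

theorem al_congr_other {n : ℕ} {L : Finset (Fin n × Fin n)} {a b c : Fin n} (ha : c ≠ a) (hb : c ≠ b)
    (x : Fin n → Bool) : applyLayer (insert (a, b) L) x c = applyLayer L x c := by
  rw [Bool.eq_iff_iff, al_true, al_true]
  simp [ha, hb]

/-- The number of zeros. -/
def Zc {n : ℕ} (x : Fin n → Bool) : ℕ := (Finset.univ.filter fun c => x c = false).card

theorem Zc_insert {n : ℕ} {L : Finset (Fin n × Fin n)} {a b : Fin n} (hab : a ≠ b)
    (hV : ValidLayer (insert (a, b) L)) (ha : ¬ UsedIn a L) (hb : ¬ UsedIn b L) (x : Fin n → Bool) :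
    Zc (applyLayer (insert (a, b) L) x) = Zc (applyLayer L x) := by
  have h1 := al_fst hV (Finset.mem_insert_self _ _) x
  have h2 := al_snd hV (Finset.mem_insert_self _ _) x
  have h3 := al_unused ha x
  have h4 := al_unused hb x
  by_cases hx : x a = true ∧ x b = false
  · unfold Zc
    refine Finset.card_equiv (Equiv.swap a b) ?_
    intro c
    simp only [Finset.mem_filter, Finset.mem_univ, true_and]
    by_cases hca : c = a
    · subst hca; simp [h1, h4, hx]
    · by_cases hcb : c = b
      · subst hcb; simp [h2, h3, hx]
      · rw [al_congr_other hca hcb, Equiv.swap_apply_of_ne_of_ne hca hcb]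
  · congr 1
    symm
    refine redundant (Finset.subset_insert _ _) hV ?_
    intro p hp hpL
    rcases Finset.mem_insert.1 hp with rfl | hp
    · simp at hx ⊢; exact hx
    · exact absurd hp hpL

theorem Zc_layer {n : ℕ} (L : Finset (Fin n × Fin n)) (hL : ValidLayer L) (x : Fin n → Bool) :
    Zc (applyLayer L x) = Zc x := by
  induction L using Finset.induction_on with
  | empty => rw [al_empty]
  | insert p L hp ih =>
    obtain ⟨a, b⟩ := p
    have hn : ∀ q ∈ L, (a, b) ≠ q := fun q hq h => hp (h ▸ hq)
    rw [Zc_insert (hL.1 _ (Finset.mem_insert_self _ _)).ne hL, ih (valid_subset (Finset.subset_insert _ _) hL)]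
    · rintro ⟨q, hq, h⟩
      have := hL.2 _ (Finset.mem_insert_self _ _) q (Finset.mem_insert_of_mem hq) (hn q hq)
      grind
    · rintro ⟨q, hq, h⟩
      have := hL.2 _ (Finset.mem_insert_self _ _) q (Finset.mem_insert_of_mem hq) (hn q hq)
      grind

theorem Zc_net {n : ℕ} (C : List (Finset (Fin n × Fin n))) (hC : ValidNet C) (x : Fin n → Bool) :
    Zc (applyNet C x) = Zc x := by
  induction C generalizing x with
  | nil => rfl
  | cons L C ih =>
    have : applyNet (L :: C) x = applyNet C (applyLayer L x) := rfl
    rw [this, ih (fun M hM => hC M (by simp [hM])), Zc_layer L (hC L (by simp))]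

theorem sorted_iff {n : ℕ} {y : Fin n → Bool} (hy : SortedVec y) (c : Fin n) :
    y c = false ↔ (c : ℕ) < Zc y := by
  constructor
  · intro h
    have : Finset.Iic c ⊆ Finset.univ.filter fun c => y c = false := by
      intro e he
      have := Bool.le_iff_imp.1 (hy e c (Finset.mem_Iic.1 he))
      simp; grind
    have := Finset.card_le_card this
    rw [Fin.card_Iic] at this
    unfold Zc; omega
  · intro h
    by_contra hc
    have : (Finset.univ.filter fun c => y c = false) ⊆ Finset.Iio c := by
      intro e he
      rw [Finset.mem_Iio]
      by_contra hle
      have := Bool.le_iff_imp.1 (hy c e (not_lt.1 hle))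
      simp at he; grind
    have := Finset.card_le_card this
    rw [Fin.card_Iio] at this
    unfold Zc at h; omega

theorem Zc_update_false {n : ℕ} {x : Fin n → Bool} {a : Fin n} (h : x a = true) :
    Zc (Function.update x a false) = Zc x + 1 := by
  unfold Zc
  rw [← Finset.card_insert_of_notMem (a := a) (by simp [h])]
  congr 1
  ext c
  by_cases hc : c = a <;> simp [Function.update_apply, hc]

theorem Zc_update_true {n : ℕ} {x : Fin n → Bool} {b : Fin n} (h : x b = false) :
    Zc x = Zc (Function.update x b true) + 1 := by
  rw [← Zc_update_false (a := b) (by simp)]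
  congr 1
  simp [h]

theorem long_redundant {n : ℕ} {Q : List (Finset (Fin n × Fin n))} {M : Finset (Fin n × Fin n)}
    (hQ : ValidNet Q) (hM : ValidLayer M) (hs : ∀ x, SortedVec (applyLayer M (applyNet Q x)))
    {i j : Fin n} (hij : (i, j) ∈ M) (hlt : (i : ℕ) + 2 ≤ j) (x : Fin n → Bool) :
    applyNet Q x i = true → applyNet Q x j = true := by
  have hZ : ∀ x, Zc (applyLayer M (applyNet Q x)) = Zc x := fun x => by
    rw [Zc_layer M hM, Zc_net Q hQ]
  have H1 : ∀ x, (i : ℕ) < Zc x → Zc x ≤ j →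
      (applyNet Q x i = false ↔ applyNet Q x j = true) := by
    intro x h1 h2
    have a1 := (sorted_iff (hs x) i).2 (by rw [hZ]; exact h1)
    have a2 := (sorted_iff (hs x) j).not.2 (by rw [hZ]; omega)
    rw [al_fst hM hij] at a1
    rw [al_snd hM hij] at a2
    grind
  have H2 : ∀ x y, (∀ c, x c = true → y c = true) → (i : ℕ) < Zc x → Zc x ≤ j →
      (i : ℕ) < Zc y → Zc y ≤ j → (applyNet Q x i = false ↔ applyNet Q y i = false) := by
    intro x y hxy h1 h2 h3 h4
    have b1 := an_mono Q hxy i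
    have b2 := an_mono Q hxy j
    have := H1 x h1 h2
    have := H1 y h3 h4
    grind
  have H3 : ∀ k : ℕ, (i : ℕ) < k → k ≤ j → ∀ m : ℕ, ∀ x, Zc x = k →
      (Finset.univ.filter fun c : Fin n => x c ≠ decide (k ≤ (c : ℕ))).card = m →
      applyNet Q x i = false := by
    intro k hk1 hk2 m
    induction m using Nat.strong_induction_on with
    | _ m ih =>
    intro x hx hm
    have hcard : (Finset.univ.filter fun c : Fin n => (c : ℕ) < k).card = k := by
      have : (Finset.univ.filter fun c : Fin n => (c : ℕ) < k) = Finset.Iio (⟨k, by omega⟩ : Fin n) := by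
        ext c; simp [Fin.lt_def]
      rw [this, Fin.card_Iio]
    have hfin : ((Finset.univ.filter fun c => x c = false) =
        (Finset.univ.filter fun c : Fin n => (c : ℕ) < k)) → applyNet Q x i = false := by
      intro he
      have hxs : ∀ c, x c = false ↔ (c : ℕ) < k := by
        intro c
        have := Finset.ext_iff.1 he c
        simpa using this
      rw [an_sorted Q hQ, hxs]
      · exact hk1
      · intro a b hab
        rw [Bool.le_iff_imp]
        have := hxs a
        have := hxs b
        have : (a : ℕ) ≤ b := hab
        grind
    by_cases hb : ∃ b, x b = false ∧ k ≤ (b : ℕ)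
    swap
    · push Not at hb
      apply hfin
      apply Finset.eq_of_subset_of_card_le
      · intro c hc; simp at hc ⊢; exact hb c hc
      · rw [hcard]; exact hx.ge
    by_cases ha : ∃ a, x a = true ∧ (a : ℕ) < k
    swap
    · push Not at ha
      apply hfin
      symm
      apply Finset.eq_of_subset_of_card_le
      · intro c hc; simp at hc ⊢
        have := ha c; grind
      · rw [hcard]; exact hx.le
    obtain ⟨b, hb1, hb2⟩ := hb
    obtain ⟨a, ha1, ha2⟩ := ha
    have hab : a ≠ b := by rintro rfl; omega
    have e1 : Zc (Function.update x a false) = k + 1 := by rw [Zc_update_false ha1, hx]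
    have e2 := Zc_update_true hb1
    set y := Function.update (Function.update x a false) b true with hy
    have hyc : y = Function.update (Function.update x b true) a false := by
      rw [hy, Function.update_comm hab]
    have e3 : Zc y = k := by
      have := Zc_update_true (x := Function.update x a false) (b := b) (by simp [hab.symm, hb1])
      rw [← hy] at this
      omega
    have hgy : applyNet Q y i = false := by
      refine ih _ ?_ y e3 rfl
      rw [← hm]
      apply Finset.card_lt_card
      rw [Finset.ssubset_iff_of_subset]
      · refine ⟨a, ?_, ?_⟩
        · simp [ha1]; omega
        · simp [hyc]; omega
      · intro c hc
        simp only [Finset.mem_filter, Finset.mem_univ, true_and, hy, Function.update_apply] at hc ⊢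
        by_cases c1 : c = a
        · subst c1; simp [hab] at hc; omega
        · by_cases c2 : c = b
          · subst c2; simp at hc; omega
          · simpa [c1, c2] using hc
    by_cases hkj : k + 1 ≤ j
    · rw [← H2 (Function.update x a false) x _ (by omega) (by omega) (by omega) (by omega)]
      · rw [H2 (Function.update x a false) y _ (by omega) (by omega) (by omega) (by omega)]
        · exact hgy
        · intro c; simp only [hy, Function.update_apply]; grind
      · intro c; simp only [Function.update_apply]; grind
    · rw [H2 x (Function.update x b true) _ (by omega) (by omega) (by omega) (by omega)]
      · rw [← H2 y (Function.update x b true) _ (by omega) (by omega) (by omega) (by omega)]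
        · exact hgy
        · intro c; simp only [hyc, Function.update_apply]; grind
      · intro c; simp only [Function.update_apply]; grind
  by_cases hr : (i : ℕ) < Zc x ∧ Zc x ≤ j
  · have := H3 (Zc x) hr.1 hr.2 _ x rfl rfl
    intro h; rw [this] at h; cases h
  · have a1 := sorted_iff (hs x) i
    have a2 := sorted_iff (hs x) j
    rw [hZ] at a1 a2
    rw [al_fst hM hij] at a1
    rw [al_snd hM hij] at a2
    intro h
    by_contra hj
    simp only [Bool.not_eq_true] at hj
    simp [h, hj] at a1 a2
    omega

theorem an_append {n : ℕ} (Q : List (Finset (Fin n × Fin n))) (M : Finset (Fin n × Fin n))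
    (x : Fin n → Bool) : applyNet (Q ++ [M]) x = applyLayer M (applyNet Q x) := by
  simp [applyNet]

theorem sn_iff {n : ℕ} (Q : List (Finset (Fin n × Fin n))) (M : Finset (Fin n × Fin n)) :
    SortingNet (Q ++ [M]) ↔
      ValidNet Q ∧ ValidLayer M ∧ ∀ x, SortedVec (applyLayer M (applyNet Q x)) := by
  unfold SortingNet ValidNet
  simp only [an_append, List.mem_append, List.mem_singleton]
  constructor
  · rintro ⟨h1, h2⟩
    exact ⟨fun L hL => h1 L (Or.inl hL), h1 M (Or.inr rfl), h2⟩
  · rintro ⟨h1, h2, h3⟩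
    refine ⟨?_, h3⟩
    rintro L (hL | rfl)
    · exact h1 L hL
    · exact h2

theorem exists_llnf {n : ℕ} {Q : List (Finset (Fin n × Fin n))} {M : Finset (Fin n × Fin n)}
    (h : SortingNet (Q ++ [M])) : ∃ M', SortingNet (Q ++ [M']) ∧ LLNF (Q ++ [M']) := by
  obtain ⟨hQ, hM, hs⟩ := (sn_iff Q M).1 h
  let S : Set (Finset (Fin n × Fin n)) :=
    {M' | SortingNet (Q ++ [M']) ∧ ∀ p ∈ M', (p.2 : ℕ) = (p.1 : ℕ) + 1}
  have hne : (M.filter fun p => (p.2 : ℕ) = (p.1 : ℕ) + 1) ∈ S := by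
    refine ⟨(sn_iff _ _).2 ⟨hQ, valid_subset (Finset.filter_subset _ _) hM, fun x => ?_⟩, ?_⟩
    · rw [redundant (Finset.filter_subset _ _) hM]
      · exact hs x
      · rintro ⟨i, j⟩ hp hnp
        have hlt : i < j := hM.1 _ hp
        simp only [Finset.mem_filter, hp, true_and] at hnp
        exact long_redundant hQ hM hs hp (by have : (i : ℕ) < j := hlt; omega) x
    · intro p hp; exact (Finset.mem_filter.1 hp).2
  obtain ⟨M', -, hmax⟩ := (Set.toFinite S).exists_le_maximal hne
  have hM' := hmax.prop
  refine ⟨M', hM'.1, ?_⟩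
  have hget : (Q ++ [M']).getD ((Q ++ [M']).length - 1) ∅ = M' := by simp
  unfold LLNF
  rw [hget]
  refine ⟨hM'.2, ?_⟩
  intro i j hij
  by_contra hu
  push Not at hu
  obtain ⟨_, hV, hs'⟩ := (sn_iff _ _).1 hM'.1
  have hlt : i < j := by rw [Fin.lt_def]; omega
  have hV2 := valid_insert hV hlt hu.1 hu.2
  have hin : insert (i, j) M' ∈ S := by
    refine ⟨(sn_iff _ _).2 ⟨hQ, hV2, fun x => ?_⟩, ?_⟩
    · rw [← redundant (Finset.subset_insert _ _) hV2]
      · exact hs' x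
      · intro p hp hpn
        rcases Finset.mem_insert.1 hp with rfl | hp
        · have := Bool.le_iff_imp.1 (hs' x i j hlt.le)
          rwa [al_unused hu.1, al_unused hu.2] at this
        · exact absurd hp hpn
    · intro p hp
      rcases Finset.mem_insert.1 hp with rfl | hp
      · exact hij
      · exact hM'.2 p hp
  have := hmax.le_of_ge hin (Finset.subset_insert _ _) (Finset.mem_insert_self _ _)
  exact hu.1 ⟨_, this, Or.inl rfl⟩

theorem block_unused {n : ℕ} {C : List (Finset (Fin n × Fin n))} {k : ℕ}
    {M : Finset (Fin n × Fin n)} (hC : ∀ L ∈ C.drop k, L = M) {A : Finset (Fin n)}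
    (hA : IsBlock C k A) {a c : Fin n} (haA : a ∈ A) (hcA : c ∈ A) (ha : ¬ UsedIn a M) : c = a := by
  have key : ∀ x y, blockRel C k x y → (x = a ↔ y = a) := by
    intro x y h
    unfold blockRel at h
    induction h with
    | rel x y h =>
      obtain ⟨L, hL, h⟩ := h
      rw [hC L hL] at h
      unfold UsedIn at ha
      push Not at ha
      rcases h with h | h
      · have := ha _ h; simp at this; tauto
      · have := ha _ h; simp at this; tauto
    | refl => rfl
    | symm _ _ _ ih => exact ih.symm
    | trans _ _ _ _ _ ih1 ih2 => exact ih1.trans ih2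
  obtain ⟨i, hi⟩ := hA
  have h1 := key _ _ ((hi a).1 haA)
  have h2 := key _ _ ((hi c).1 hcA)
  tauto

theorem cosat_small {n : ℕ} {C : List (Finset (Fin n × Fin n))} (hlen : C.length ≤ 1)
    (h : LLNF C) : CoSaturated C := by
  have e2 : C.length - 2 = C.length - 1 := by omega
  have hC : ∀ L ∈ C.drop (C.length - 1), L = C.getD (C.length - 1) ∅ := by
    match C, hlen with
    | [], _ => simp
    | [M], _ => simp
  refine ⟨h, ?_, ?_⟩
  · rintro A B hA hB ⟨_, nA, nB, hadj⟩ ⟨⟨a, haA, ha⟩, b, hbB, hb⟩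
    rw [e2] at ha hb
    have m1 := block_unused hC hA haA (A.max'_mem nA) ha
    have m2 := block_unused hC hA haA (A.min'_mem nA) ha
    have m3 := block_unused hC hB hbB (B.max'_mem nB) hb
    have m4 := block_unused hC hB hbB (B.min'_mem nB) hb
    rw [m1, m2, m3, m4] at hadj
    rcases hadj with hadj | hadj
    · exact (h.2 a b hadj.symm).elim ha hb
    · exact (h.2 b a hadj.symm).elim hb ha
  · intro p hp hu
    rw [e2] at hu
    exact absurd ⟨p, hp, Or.inl rfl⟩ hu

theorem block_closed {n : ℕ} {Q : List (Finset (Fin n × Fin n))} {M : Finset (Fin n × Fin n)}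
    {A : Finset (Fin n)} (hA : IsBlock (Q ++ [M]) ((Q ++ [M]).length - 1) A) {a c : Fin n}
    (ha : a ∈ A) (h : (a, c) ∈ M ∨ (c, a) ∈ M) : c ∈ A := by
  obtain ⟨i, hi⟩ := hA
  rw [hi] at ha ⊢
  exact ha.trans _ _ _ (Relation.EqvGen.rel _ _ ⟨M, by simp, h⟩)

theorem cosat_big {n : ℕ} (P : List (Finset (Fin n × Fin n))) (L M : Finset (Fin n × Fin n))
    (h : SortingNet (P ++ [L] ++ [M])) : ∃ L' M',
      SortingNet (P ++ [L'] ++ [M']) ∧ CoSaturated (P ++ [L'] ++ [M']) := by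
  let S : Set (Finset (Fin n × Fin n)) := {L' | ∃ M', SortingNet (P ++ [L'] ++ [M'])}
  obtain ⟨L', -, hmax⟩ := (Set.toFinite S).exists_le_maximal (a := L) ⟨M, h⟩
  obtain ⟨M0, hM0⟩ := hmax.prop
  obtain ⟨M', hs, hll⟩ := exists_llnf hM0
  refine ⟨L', M', hs, hll, ?_⟩
  have hget1 : (P ++ [L'] ++ [M']).getD ((P ++ [L'] ++ [M']).length - 1) ∅ = M' := by simp
  have hget2 : (P ++ [L'] ++ [M']).getD ((P ++ [L'] ++ [M']).length - 2) ∅ = L' := by simp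
  rw [hget1, hget2]
  obtain ⟨hPL, hM, hsort⟩ := (sn_iff _ _).1 hs
  have hP : ValidNet P := fun K hK => hPL K (by simp [hK])
  have hL : ValidLayer L' := hPL L' (by simp)
  have key : ∀ a b, a < b → ¬ UsedIn a L' → ¬ UsedIn b L' →
      (∀ x, applyLayer M' (applyLayer (insert (a, b) L') (applyNet P x)) =
        applyLayer M' (applyLayer L' (applyNet P x))) → False := by
    intro a b hab ha hb hx
    have hV := valid_insert hL hab ha hb
    have hin : insert (a, b) L' ∈ S := by
      refine ⟨M', (sn_iff _ _).2 ⟨?_, hM, ?_⟩⟩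
      · intro K hK
        rcases List.mem_append.1 hK with hK | hK
        · exact hP K hK
        · rw [List.mem_singleton.1 hK]; exact hV
      · intro x
        rw [an_append, hx, ← an_append]
        exact hsort x
    have := hmax.le_of_ge hin (Finset.subset_insert _ _) (Finset.mem_insert_self _ _)
    exact ha ⟨_, this, Or.inl rfl⟩
  have key2 : ∀ A B : Finset (Fin n),
      IsBlock (P ++ [L'] ++ [M']) ((P ++ [L'] ++ [M']).length - 1) A →
      IsBlock (P ++ [L'] ++ [M']) ((P ++ [L'] ++ [M']).length - 1) B →
      ∀ (hA : A.Nonempty) (hB : B.Nonempty), (A.max' hA : ℕ) + 1 = (B.min' hB : ℕ) →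
      ∀ a ∈ A, ∀ b ∈ B, ¬ UsedIn a L' → ¬ UsedIn b L' → False := by
    intro A B hA hB nA nB hadj a haA b hbB ha hb
    have hlt : ∀ c ∈ A, ∀ e ∈ B, c < e := by
      intro c hc e he
      have h1 : (c : ℕ) ≤ A.max' nA := A.le_max' c hc
      have h2 : (B.min' nB : ℕ) ≤ e := B.min'_le e he
      rw [Fin.lt_def]; omega
    have hab := hlt a haA b hbB
    refine key a b hab ha hb fun x => ?_
    rw [← redundant (Finset.subset_insert _ _) (valid_insert hL hab ha hb)]
    intro p hp hpn
    rcases Finset.mem_insert.1 hp with rfl | hp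
    swap
    · exact absurd hp hpn
    simp only
    rw [← al_unused ha (applyNet P x), ← al_unused hb (applyNet P x), ← an_append]
    intro hua
    by_contra hub
    have hx := hsort x
    have h1 : ∃ c ∈ A, applyLayer M' (applyNet (P ++ [L']) x) c = true := by
      by_cases hj : ∃ j, (a, j) ∈ M'
      · obtain ⟨j, hj⟩ := hj
        exact ⟨j, block_closed hA haA (Or.inl hj), by rw [al_snd hM hj, hua]; rfl⟩
      · push Not at hj
        exact ⟨a, haA, by rw [al_true]; exact Or.inl ⟨hua, fun j h => absurd h (hj j)⟩⟩
    have h2 : ∃ e ∈ B, ¬ applyLayer M' (applyNet (P ++ [L']) x) e = true := by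
      by_cases hj : ∃ j, (j, b) ∈ M'
      · obtain ⟨j, hj⟩ := hj
        refine ⟨j, block_closed hB hbB (Or.inr hj), ?_⟩
        rw [al_fst hM hj, Bool.and_eq_true]; tauto
      · push Not at hj
        refine ⟨b, hbB, ?_⟩
        rw [al_true]
        rintro (⟨h, _⟩ | ⟨i, h, _⟩)
        · exact hub h
        · exact hj i h
    obtain ⟨c, hcA, hc⟩ := h1
    obtain ⟨e, heB, he⟩ := h2
    exact he (Bool.le_iff_imp.1 (hx c e (hlt c hcA e heB).le) hc)
  constructor
  · rintro A B hA hB ⟨_, nA, nB, hadj⟩ ⟨⟨a, haA, ha⟩, b, hbB, hb⟩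
    rcases hadj with hadj | hadj
    · exact key2 A B hA hB nA nB hadj a haA b hbB ha hb
    · exact key2 B A hB hA nB nA hadj b hbB a haA hb ha
  · rintro ⟨a, b⟩ hp ha hb
    exfalso
    have hab : a < b := hM.1 _ hp
    refine key a b hab ha hb fun x => ?_
    have hV := valid_insert hL hab ha hb
    have f1 := al_fst hV (Finset.mem_insert_self _ _) (applyNet P x)
    have f2 := al_snd hV (Finset.mem_insert_self _ _) (applyNet P x)
    have f3 := al_unused ha (applyNet P x)
    have f4 := al_unused hb (applyNet P x)
    funext c
    by_cases hca : c = a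
    · subst hca
      rw [al_fst hM hp, al_fst hM hp, f1, f2, f3, f4]
      cases applyNet P x c <;> cases applyNet P x b <;> rfl
    by_cases hcb : c = b
    · subst hcb
      rw [al_snd hM hp, al_snd hM hp, f1, f2, f3, f4]
      cases applyNet P x c <;> cases applyNet P x a <;> rfl
    have g1 : ∀ j, (c, j) ∈ M' → j ≠ a ∧ j ≠ b := by
      intro j hj
      have := hM.2 _ hj _ hp (by simp [hca])
      exact this.2.2
    have g2 : ∀ j, (j, c) ∈ M' → j ≠ a ∧ j ≠ b := by
      intro j hj
      have := hM.2 _ hj _ hp (by simp [hcb])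
      exact ⟨this.1, this.2.1⟩
    rw [Bool.eq_iff_iff, al_true M', al_true M', al_congr_other hca hcb]
    have k1 : ∀ j, (c, j) ∈ M' → applyLayer (insert (a, b) L') (applyNet P x) j =
        applyLayer L' (applyNet P x) j :=
      fun j hj => al_congr_other (g1 j hj).1 (g1 j hj).2 _
    have k2 : ∀ j, (j, c) ∈ M' → applyLayer (insert (a, b) L') (applyNet P x) j =
        applyLayer L' (applyNet P x) j :=
      fun j hj => al_congr_other (g2 j hj).1 (g2 j hj).2 _
    constructor
    · rintro (⟨h1, h2⟩ | ⟨i, h1, h2⟩)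
      · exact Or.inl ⟨h1, fun j hj => k1 j hj ▸ h2 j hj⟩
      · exact Or.inr ⟨i, h1, k2 i h1 ▸ h2⟩
    · rintro (⟨h1, h2⟩ | ⟨i, h1, h2⟩)
      · exact Or.inl ⟨h1, fun j hj => (k1 j hj).symm ▸ h2 j hj⟩
      · exact Or.inr ⟨i, h1, (k2 i h1).symm ▸ h2⟩

/-- if there is a sorting network on `n` channels of depth `d`, then there
is a co-saturated sorting network on `n` channels of depth `d`. -/
theorem exists_cosaturated_sorting_network {n d : ℕ}
    (h : ∃ C : List (Finset (Fin n × Fin n)), C.length = d ∧ SortingNet C) :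
    ∃ N : List (Finset (Fin n × Fin n)), N.length = d ∧ SortingNet N ∧ CoSaturated N := by
  obtain ⟨C, hlen, hC⟩ := h
  rcases List.eq_nil_or_concat C with rfl | ⟨Q, M, rfl⟩
  · refine ⟨[], hlen, hC, cosat_small (by simp) ⟨by simp, ?_⟩⟩
    intro i j hij
    exfalso
    have hlt : i < j := by rw [Fin.lt_def]; omega
    have := Bool.le_iff_imp.1 (hC.2 (fun c => decide (c = i)) i j hlt.le)
    simp [applyNet] at this
    exact hlt.ne' this
  · rw [List.concat_eq_append] at hC hlen
    rcases List.eq_nil_or_concat Q with rfl | ⟨P, L, rfl⟩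
    · obtain ⟨M', h1, h2⟩ := exists_llnf hC
      exact ⟨_, by simpa using hlen, h1, cosat_small (by simp) h2⟩
    · rw [List.concat_eq_append] at hC hlen
      obtain ⟨L', M', h1, h2⟩ := cosat_big P L M hC
      exact ⟨_, by simpa using hlen, h1, h2⟩
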